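/- Let G be a finite group, C a conjugacy class of G, g an element of C, and k ≥ 1. Then the number of k-tuples (g_1, ..., g_k) in C^k with g_1 ⋯ g_k = 1 equals (|C|^k / |G|) · Σ_{χ ∈ Irr(G)} χ(g)^k / χ(1)^{k-2}, where the sum is over irreducible complex characters of G. -/

import Mathlib

open scoped BigOperators

/-- The set of irreducible complex characters of `G`, as functions `G → ℂ`. -/
def IrrChar (G : Type) [Group G] : Set (G → ℂ) :=
  {χ | ∃ V : FDRep ℂ G, CategoryTheory.Simple V ∧ χ = V.character}

open Module in
theorem simple_of_irreducible {G : Type} [Group G] [Fintype G] {W : Type} [AddCommGroup W]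
    [Module ℂ W] [FiniteDimensional ℂ W] (ρ : Representation ℂ G W) [ρ.IsIrreducible] :
    CategoryTheory.Simple (FDRep.of ρ) := by
  have hc : (Nat.card G : ℂ) ≠ 0 := NeZero.ne _
  have := invertibleOfNonzero hc
  rw [FDRep.simple_iff_char_is_norm_one]
  have h := Representation.card_inv_mul_sum_char_mul_char_eq_finrank ρ ρ
  rw [Representation.IsIrreducible.finrank_intertwiningMap_self, Nat.cast_one,
    inv_mul_eq_one₀ hc] at h
  exact h.symm

open Module in
theorem exists_decomp {G : Type} [Group G] [Fintype G] (n : ℕ) : ∀ {W : Type} [AddCommGroup W]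
    [Module ℂ W] [FiniteDimensional ℂ W] (ρ : Representation ℂ G W), finrank ℂ W = n →
    ∃ L : List (G → ℂ), (∀ χ ∈ L, χ ∈ IrrChar G) ∧ ρ.character = L.sum := by
  induction n using Nat.strong_induction_on with
  | _ n ih =>
  intro W _ _ _ ρ hn
  by_cases hW : Subsingleton W
  · refine ⟨[], by simp, ?_⟩
    ext g
    have : ρ g = 0 := by ext; exact Subsingleton.elim _ _
    simp [Representation.character, this]
  have hW' : Nontrivial W := not_subsingleton_iff_nontrivial.mp hW
  by_cases hirr : ρ.IsIrreducible
  · refine ⟨[ρ.character], ?_, by simp⟩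
    simp only [List.mem_singleton, forall_eq]
    exact ⟨FDRep.of ρ, simple_of_irreducible ρ, rfl⟩
  have hss : ρ.IsSemisimpleRepresentation := by
    rw [Representation.isSemisimpleRepresentation_iff_isSemisimpleModule_asModule]
    infer_instance
  have hnt : Nontrivial (Subrepresentation ρ) := ⟨⊥, ⊤, fun h => by
    have h2 : (⊥ : Submodule ℂ W) = ⊤ := congrArg Subrepresentation.toSubmodule h
    exact bot_ne_top h2⟩
  obtain ⟨p, hp0, hp1⟩ : ∃ p : Subrepresentation ρ, p ≠ ⊥ ∧ p ≠ ⊤ := by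
    by_contra! hcon
    exact hirr ⟨fun a => by
      by_cases ha : a = ⊥
      · exact Or.inl ha
      · exact Or.inr (hcon a ha)⟩
  obtain ⟨q, hpq⟩ := hss.exists_isCompl p
  have hc : IsCompl p.toSubmodule q.toSubmodule := by
    constructor
    · rw [disjoint_iff]
      exact congrArg Subrepresentation.toSubmodule hpq.inf_eq_bot
    · rw [codisjoint_iff]
      exact congrArg Subrepresentation.toSubmodule hpq.sup_eq_top
  have hadd := Submodule.finrank_add_eq_of_isCompl hc
  have hpn : p.toSubmodule ≠ ⊥ := fun h => hp0 (Subrepresentation.toSubmodule_injective h)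
  have hpt : p.toSubmodule ≠ ⊤ := fun h => hp1 (Subrepresentation.toSubmodule_injective h)
  have h1 : 0 < finrank ℂ p.toSubmodule := by
    rw [Nat.pos_iff_ne_zero, ne_eq, Submodule.finrank_eq_zero]; exact hpn
  have h2 : finrank ℂ p.toSubmodule < finrank ℂ W := Submodule.finrank_lt hpt
  obtain ⟨L1, hL1, e1⟩ := ih _ (by omega) p.toRepresentation rfl
  obtain ⟨L2, hL2, e2⟩ := ih (finrank ℂ q.toSubmodule) (by omega) q.toRepresentation rfl
  refine ⟨L1 ++ L2, ?_, ?_⟩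
  · intro χ hχ
    rcases List.mem_append.mp hχ with h | h
    exacts [hL1 _ h, hL2 _ h]
  · rw [List.sum_append, ← e1, ← e2]
    ext g
    have hint : DirectSum.IsInternal (fun b : Bool => cond b p.toSubmodule q.toSubmodule) :=
      (DirectSum.isInternal_submodule_iff_isCompl _ (i := true) (j := false) (by simp)
        (by ext b; cases b <;> simp)).mpr hc
    have hmaps : ∀ b : Bool, Set.MapsTo (ρ g) (cond b p.toSubmodule q.toSubmodule : Submodule ℂ W)
        (cond b p.toSubmodule q.toSubmodule : Submodule ℂ W) := by
      intro b
      cases b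
      · exact q.apply_mem_toSubmodule g
      · exact p.apply_mem_toSubmodule g
    have := LinearMap.trace_eq_sum_trace_restrict hint hmaps
    rw [Fintype.sum_bool] at this
    exact this

theorem irr_ortho {G : Type} [Group G] [Fintype G] {χ ψ : G → ℂ} (hχ : χ ∈ IrrChar G)
    (hψ : ψ ∈ IrrChar G) : ∑ g : G, χ g * ψ g⁻¹ = if χ = ψ then (Fintype.card G : ℂ) else 0 := by
  classical
  have hc : (Nat.card G : ℂ) ≠ 0 := NeZero.ne _
  have := invertibleOfNonzero hc
  obtain ⟨V, hV, rfl⟩ := hχ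
  obtain ⟨W, hW, rfl⟩ := hψ
  split_ifs with h
  · rw [← h]
    have := (FDRep.simple_iff_char_is_norm_one V).mp hV
    rw [this, Nat.card_eq_fintype_card]
  · have h2 := FDRep.char_orthonormal V W
    rw [if_neg (fun ⟨i⟩ => h (FDRep.char_iso i))] at h2
    simpa [hc] using h2

theorem irr_one_ne {G : Type} [Group G] [Fintype G] {χ : G → ℂ} (hχ : χ ∈ IrrChar G) :
    χ 1 ≠ 0 := by
  obtain ⟨V, hV, rfl⟩ := hχ
  intro h
  rw [FDRep.char_one, Nat.cast_eq_zero] at h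
  have h2 := (FDRep.simple_iff_char_is_norm_one V).mp hV
  have : Subsingleton V := Module.finrank_zero_iff.mp h
  have h0 : ∀ g, V.character g = 0 := by
    intro g
    have : V.ρ g = 0 := by ext; exact Subsingleton.elim _ _
    simp [FDRep.character, this]
  have hc : (Nat.card G : ℂ) ≠ 0 := NeZero.ne _
  exact hc (by rw [← h2]; simp [h0])

theorem regular_char {G : Type} [Group G] [Fintype G] [DecidableEq G] (g : G) :
    (Representation.leftRegular ℂ G).character g = if g = 1 then (Fintype.card G : ℂ) else 0 := by
  classical
  unfold Representation.character
  rw [LinearMap.trace_eq_matrix_trace ℂ (MonoidAlgebra.basis G ℂ), Matrix.trace]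
  have : ∀ h : G, (LinearMap.toMatrix (MonoidAlgebra.basis G ℂ) (MonoidAlgebra.basis G ℂ)
      (Representation.leftRegular ℂ G g)).diag h = if g = 1 then 1 else 0 := by
    intro h
    rw [Matrix.diag_apply, LinearMap.toMatrix_apply, MonoidAlgebra.basis_apply,
      Representation.ofMulAction_single]
    have : (MonoidAlgebra.single (g • h) (1 : ℂ)) = MonoidAlgebra.basis G ℂ (g • h) := rfl
    rw [this, Module.Basis.repr_self, Finsupp.single_apply]
    simp
  rw [Finset.sum_congr rfl fun h _ => this h]
  simp

theorem irr_regular {G : Type} [Group G] [Fintype G] [DecidableEq G] :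
    ∃ S : Finset (G → ℂ), (S : Set (G → ℂ)) = IrrChar G ∧
      ∀ g : G, ∑ χ ∈ S, χ 1 * χ g = if g = 1 then (Fintype.card G : ℂ) else 0 := by
  classical
  obtain ⟨L, hL, e⟩ := exists_decomp _ (Representation.leftRegular ℂ G) rfl
  have hcard : (Fintype.card G : ℂ) ≠ 0 := by simp
  have hreg : ∀ g, L.sum g = if g = 1 then (Fintype.card G : ℂ) else 0 := by
    intro g; rw [← e, regular_char]
  have hcount : ∀ χ ∈ IrrChar G, (L.count χ : ℂ) = χ 1 := by
    intro χ hχ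
    have h1 : ∑ g : G, L.sum g * χ g⁻¹ = Fintype.card G * χ 1 := by
      simp [hreg]
    have h2 : ∀ L : List (G → ℂ), (∀ χ ∈ L, χ ∈ IrrChar G) →
        ∑ g : G, L.sum g * χ g⁻¹ = Fintype.card G * L.count χ := by
      intro L
      induction L with
      | nil => simp
      | cons ψ L ih =>
        intro h
        have h3 := ih (fun χ hχ => h χ (List.mem_cons_of_mem _ hχ))
        have h4 := irr_ortho (h ψ List.mem_cons_self) hχ
        simp only [List.sum_cons, Pi.add_apply, add_mul, Finset.sum_add_distrib, h3, h4,
          List.count_cons, beq_iff_eq]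
        split_ifs <;> push_cast <;> ring
    rw [h2 L hL] at h1
    exact mul_left_cancel₀ hcard h1
  refine ⟨L.toFinset, ?_, ?_⟩
  · ext χ
    simp only [List.coe_toFinset, Set.mem_ofPred_eq]
    refine ⟨hL χ, fun h => ?_⟩
    have := hcount χ h
    rw [← List.count_pos_iff]
    rw [Nat.pos_iff_ne_zero]
    intro h0
    rw [h0] at this
    exact irr_one_ne h (by simpa using this.symm)
  · intro g
    rw [← hreg g, Finset.sum_list_count]
    rw [Finset.sum_apply]
    refine Finset.sum_congr rfl fun χ hχ => ?_
    rw [← hcount χ (hL χ (List.mem_toFinset.mp hχ))]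
    simp

theorem sum_scalar {G : Type} [Group G] [Fintype G] (V : FDRep ℂ G) (hV : CategoryTheory.Simple V)
    (S : Finset G) (hS : ∀ h, ∀ x ∈ S, h * x * h⁻¹ ∈ S) :
    ∃ c : ℂ, ∑ x ∈ S, V.ρ x = c • (LinearMap.id : V →ₗ[ℂ] V) := by
  have hc : (Nat.card G : ℂ) ≠ 0 := NeZero.ne _
  have := invertibleOfNonzero hc
  have h1 : Module.finrank ℂ (Representation.IntertwiningMap V.ρ V.ρ) = 1 := by
    have h := Representation.card_inv_mul_sum_char_mul_char_eq_finrank V.ρ V.ρ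
    have h2 := (FDRep.simple_iff_char_is_norm_one V).mp hV
    have h3 : ∑ g : G, Representation.character V.ρ g * Representation.character V.ρ g⁻¹
      = Nat.card G := h2
    rw [h3, inv_mul_cancel₀ hc] at h
    exact_mod_cast h.symm
  have hn : Representation.IntertwiningMap.id V.ρ ≠ 0 := by
    intro h0
    have h4 : (LinearMap.id : V →ₗ[ℂ] V) = 0 :=
      congrArg Representation.IntertwiningMap.toLinearMap h0
    have h5 : V.character 1 = 0 := by
      unfold FDRep.character
      rw [map_one]
      change LinearMap.trace ℂ V LinearMap.id = 0
      rw [h4, map_zero]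
    exact irr_one_ne ⟨V, hV, rfl⟩ h5
  let f : Representation.IntertwiningMap V.ρ V.ρ := ⟨∑ x ∈ S, V.ρ x, by
    intro g
    change (∑ x ∈ S, V.ρ x) * V.ρ g = V.ρ g * ∑ x ∈ S, V.ρ x
    rw [Finset.sum_mul, Finset.mul_sum]
    refine Finset.sum_bij' (fun x _ => g⁻¹ * x * g) (fun x _ => g * x * g⁻¹) ?_ ?_ ?_ ?_ ?_
    · intro x hx; simpa using hS g⁻¹ x hx
    · intro x hx; exact hS g x hx
    · intro x hx; group
    · intro x hx; group
    · intro x hx; rw [← map_mul, ← map_mul]; congr 1; group⟩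
  obtain ⟨c, hc⟩ := (finrank_eq_one_iff_of_nonzero' _ hn).mp h1 f
  refine ⟨c, ?_⟩
  have := congrArg Representation.IntertwiningMap.toLinearMap hc
  exact this.symm

theorem list_pow {α R : Type*} [Fintype α] [Ring R] (a : α → R) (k : ℕ) :
    ∑ t : Fin k → α, (List.ofFn fun i => a (t i)).prod = (∑ x, a x) ^ k := by
  induction k with
  | zero => simp
  | succ k ih =>
    rw [← (Fin.consEquiv (fun _ => α)).sum_comp, Fintype.sum_prod_type, pow_succ', ← ih,
      Finset.sum_mul]
    refine Finset.sum_congr rfl fun x _ => ?_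
    rw [Finset.mul_sum]
    refine Finset.sum_congr rfl fun t _ => ?_
    simp [List.ofFn_succ, Fin.consEquiv]

theorem char_count {G : Type} [Group G] [Fintype G] (C : ConjClasses G) (g : G)
    (hg : g ∈ C.carrier) (k : ℕ) [Fintype C.carrier] {χ : G → ℂ} (hχ : χ ∈ IrrChar G) :
    ∑ t : Fin k → C.carrier, χ (List.ofFn fun i => (t i : G)).prod
      = χ 1 * ((Nat.card C.carrier : ℂ) * χ g / χ 1) ^ k := by
  classical
  have h1 := irr_one_ne hχ
  obtain ⟨V, hV, rfl⟩ := hχ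
  obtain ⟨c, hc⟩ := sum_scalar V hV C.carrier.toFinset (by
    intro h x hx
    rw [Set.mem_toFinset, ConjClasses.mem_carrier_iff_mk_eq] at hx ⊢
    rw [← hx, ConjClasses.mk_eq_mk_iff_isConj, isConj_comm]
    exact isConj_iff.mpr ⟨h, rfl⟩)
  have hc' : ∑ x : C.carrier, V.ρ x = c • (LinearMap.id : V →ₗ[ℂ] V) := by
    rw [← hc]
    exact (Finset.sum_subtype _ (by simp) _).symm
  have htr := congrArg (LinearMap.trace ℂ V) hc'
  have hcl : ∀ x : C.carrier, V.character x = V.character g := by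
    intro x
    have hx := x.2
    rw [ConjClasses.mem_carrier_iff_mk_eq] at hx hg
    have hx2 := hx.trans hg.symm
    rw [ConjClasses.mk_eq_mk_iff_isConj, isConj_comm] at hx2
    obtain ⟨h, hh⟩ := isConj_iff.mp hx2
    rw [← hh, FDRep.char_conj]
  have hcc : c = (Nat.card C.carrier : ℂ) * V.character g / V.character 1 := by
    rw [eq_div_iff h1]
    rw [map_sum, map_smul, LinearMap.trace_id] at htr
    rw [FDRep.char_one, ← smul_eq_mul, ← htr]
    have : ∀ x : C.carrier, LinearMap.trace ℂ V (V.ρ x) = V.character g := hcl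
    simp [this]
  rw [← hcc]
  have hp := list_pow (fun x : C.carrier => V.ρ (x : G)) k
  rw [hc'] at hp
  have htr2 := congrArg (LinearMap.trace ℂ V) hp
  rw [map_sum, smul_pow, map_smul] at htr2
  have hid : (LinearMap.id : V →ₗ[ℂ] V) ^ k = LinearMap.id := one_pow k
  rw [hid, LinearMap.trace_id] at htr2
  rw [FDRep.char_one, mul_comm, ← smul_eq_mul, ← htr2]
  refine Finset.sum_congr rfl fun t _ => ?_
  unfold FDRep.character
  rw [map_list_prod, List.map_ofFn]
  rfl

theorem stmt13 {G : Type} [Group G] [Fintype G] (C : ConjClasses G) (g : G)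
    (hg : g ∈ C.carrier) (k : ℕ) (hk : 1 ≤ k) :
    (Nat.card {t : Fin k → G // (∀ i, t i ∈ C.carrier) ∧ (List.ofFn t).prod = 1} : ℂ)
      = (Nat.card C.carrier : ℂ) ^ k / (Fintype.card G : ℂ) *
        ∑ᶠ χ ∈ IrrChar G, χ g ^ k / χ 1 ^ ((k : ℤ) - 2) := by
  classical
  obtain ⟨S, hS, hreg⟩ := irr_regular (G := G)
  have hcard : (Fintype.card G : ℂ) ≠ 0 := by simp
  rw [← hS, finsum_mem_coe_finset]
  let e : {t : Fin k → G // (∀ i, t i ∈ C.carrier) ∧ (List.ofFn t).prod = 1} ≃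
      {t : Fin k → C.carrier // (List.ofFn fun i => (t i : G)).prod = 1} :=
    { toFun := fun t => ⟨fun i => ⟨t.1 i, t.2.1 i⟩, t.2.2⟩
      invFun := fun t => ⟨fun i => t.1 i, fun i => (t.1 i).2, t.2⟩
      left_inv := fun _ => rfl
      right_inv := fun _ => rfl }
  rw [Nat.card_congr e, Nat.card_eq_fintype_card, Fintype.card_subtype]
  have h1 : (Fintype.card G : ℂ) *
      ((Finset.univ.filter fun t : Fin k → C.carrier =>
        (List.ofFn fun i => (t i : G)).prod = 1).card : ℂ)
      = ∑ χ ∈ S, χ 1 * (χ 1 * ((Nat.card C.carrier : ℂ) * χ g / χ 1) ^ k) := by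
    have h2 : ∀ χ ∈ S, χ 1 * (χ 1 * ((Nat.card C.carrier : ℂ) * χ g / χ 1) ^ k)
        = ∑ t : Fin k → C.carrier, χ 1 * χ (List.ofFn fun i => (t i : G)).prod := by
      intro χ hχ
      rw [← char_count C g hg k (hS ▸ hχ : χ ∈ IrrChar G), Finset.mul_sum]
    rw [Finset.sum_congr rfl h2, Finset.sum_comm]
    simp only [hreg]
    rw [← Finset.sum_filter, Finset.sum_const, nsmul_eq_mul, mul_comm]
  rw [← mul_right_inj' hcard, h1, ← mul_assoc, mul_div_cancel₀ _ hcard, Finset.mul_sum]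
  refine Finset.sum_congr rfl fun χ hχ => ?_
  have hne : χ 1 ≠ 0 := irr_one_ne (hS ▸ hχ : χ ∈ IrrChar G)
  rw [zpow_sub₀ hne, zpow_natCast, div_pow, mul_pow]
  field_simp
  try norm_cast
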